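/- Let n ≥ 2 be an integer and let p be the smallest prime divisor of n. Let f(x) = a_d x^d + ⋯ + a_1 x + a_0 ∈ ℤ[x] have degree d ≥ 1 with gcd(a_d, …, a_1, n) = 1, and set C_d = e^{1.85 d}. Let D ⊆ ℤ/nℤ with |D| = n - c, and assume n - c ≥ C_d · n · p^{-1/d} + c. Then for every b ∈ ℤ/nℤ and every 0 ≤ k ≤ |D|, |N_f(D,k,b) - (1/n)·C(n-c, k)| ≤ C(δ(n)(n-c) + (1-δ(n))(C_d · n · p^{-1/d} + c) + k - 1, k). -/

import Mathlib

open Finset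

/-- `N_f(D, k, b)`: the number of `k`-element subsets `S ⊆ D` with `∑_{x ∈ S} f(x) = b`. -/
def polySubsetSumCount {R : Type*} [CommRing R] [DecidableEq R]
    (D : Finset R) (f : Polynomial R) (k : ℕ) (b : R) : ℕ :=
  ((D.powersetCard k).filter (fun S => ∑ x ∈ S, f.eval x = b)).card

/-- The real "binomial coefficient" `C(x, k) = x(x-1)⋯(x-k+1)/k!`. -/
noncomputable def realChoose (x : ℝ) (k : ℕ) : ℝ :=
  (∏ j ∈ Finset.range k, (x - j)) / (Nat.factorial k)

/-- `δ(n) = ∑_{i ∣ n, μ(i) = -1} 1/i`. -/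
noncomputable def deltaMoebius (n : ℕ) : ℝ :=
  ∑ i ∈ n.divisors.filter (fun i => ArithmeticFunction.moebius i = -1), (1 : ℝ) / i

/-- The coefficient `A(A+1)⋯(A+k-1)/k!` of `u ^ k` in `(1 - u)^{-A}`. -/
noncomputable def multichooseReal (A : ℝ) (k : ℕ) : ℝ :=
  (∏ j ∈ Finset.range k, (A + j)) / (Nat.factorial k)

theorem realChoose_add_sub_one (A : ℝ) (k : ℕ) :
    realChoose (A + k - 1) k = multichooseReal A k := by
  unfold realChoose multichooseReal
  rw [← Finset.prod_range_reflect]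
  congr 1
  refine Finset.prod_congr rfl fun j hj => ?_
  have hj := Finset.mem_range.1 hj
  rw [Nat.sub_sub, Nat.cast_sub (by omega)]
  push_cast
  ring

theorem realChoose_natCast (m k : ℕ) : realChoose m k = m.choose k := by
  rw [Nat.cast_choose_eq_descPochhammer_div, descPochhammer_eval_eq_prod_range, realChoose]

@[simp]
theorem multichooseReal_zero (A : ℝ) : multichooseReal A 0 = 1 := by
  simp [multichooseReal]

theorem succ_mul_multichooseReal_succ (A : ℝ) (k : ℕ) :
    (k + 1) * multichooseReal A (k + 1) = (A + k) * multichooseReal A k := by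
  unfold multichooseReal
  rw [Finset.prod_range_succ, Nat.factorial_succ]
  have : (k.factorial : ℝ) ≠ 0 := by positivity
  push_cast
  field_simp

theorem mul_multichooseReal (A : ℝ) (k : ℕ) :
    k * multichooseReal A k = A * ∑ i ∈ Finset.range k, multichooseReal A i := by
  induction k with
  | zero => simp
  | succ k ih =>
    rw [Finset.sum_range_succ, mul_add, ← ih]
    push_cast
    rw [succ_mul_multichooseReal_succ]
    ring

theorem multichooseReal_nonneg {A : ℝ} (hA : 0 ≤ A) (k : ℕ) : 0 ≤ multichooseReal A k := by
  unfold multichooseReal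
  positivity

theorem multichooseReal_monotone {A : ℝ} (hA : 1 ≤ A) : Monotone (multichooseReal A) := by
  refine monotone_nat_of_le_succ fun k => ?_
  have h := succ_mul_multichooseReal_succ A k
  have h0 := multichooseReal_nonneg (zero_le_one.trans hA) k
  have hk : (0 : ℝ) < k + 1 := by positivity
  refine le_of_mul_le_mul_left ?_ hk
  rw [h]
  exact mul_le_mul_of_nonneg_right (by linarith) h0

/-- The terms of a monotone sequence at distance a multiple of `q` from the end are at most
`1 / q` of the whole sum. -/
theorem mul_sum_filter_dvd_le {T : ℕ → ℝ} (hT : Monotone T) (h0 : ∀ i, 0 ≤ T i) {q : ℕ}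
    (hq : 0 < q) (k : ℕ) :
    q * ∑ i ∈ (Finset.range k).filter (fun i => q ∣ k - i), T i ≤ ∑ i ∈ Finset.range k, T i := by
  induction k using Nat.strong_induction_on with
  | _ k ih =>
    rcases lt_or_ge k q with hk | hk
    · rw [Finset.sum_eq_zero, mul_zero]
      · exact Finset.sum_nonneg fun i _ => h0 i
      · intro i hi
        rw [Finset.mem_filter, Finset.mem_range] at hi
        have := Nat.le_of_dvd (by omega) hi.2
        omega
    · obtain ⟨l, rfl⟩ := Nat.exists_eq_add_of_le' hk
      have hset : (Finset.range (l + q)).filter (fun i => q ∣ l + q - i)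
          = insert l ((Finset.range l).filter (fun i => q ∣ l - i)) := by
        ext i
        simp only [Finset.mem_filter, Finset.mem_range, Finset.mem_insert]
        constructor
        · rintro ⟨h1, h2⟩
          rcases lt_trichotomy i l with h | h | h
          · refine Or.inr ⟨h, ?_⟩
            rw [show l + q - i = (l - i) + q by omega] at h2
            simpa using h2
          · exact Or.inl h
          · have := Nat.le_of_dvd (by omega) h2
            omega
        · rintro (rfl | ⟨h1, h2⟩)
          · exact ⟨by omega, by simp⟩
          · refine ⟨by omega, ?_⟩
            rw [show l + q - i = (l - i) + q by omega]
            simpa using h2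
      rw [hset, Finset.sum_insert (by simp), Finset.sum_range_add, mul_add, add_comm]
      refine add_le_add (ih l (by omega)) ?_
      calc (q : ℝ) * T l = ∑ i ∈ Finset.range q, T l := by simp
        _ ≤ _ := Finset.sum_le_sum fun i _ => hT (by omega)

/-- If all power sums `∑ z ^ j` are at most `s`, except for those with `q ∣ j` which are at most
`s + w`, then the elementary symmetric sums are at most the coefficients of
`(1 - u)^{-A}` for `A ≥ s + w / q`. -/
theorem norm_esymm_le {σ : Type*} [Fintype σ] (z : σ → ℂ) {s w A : ℝ}
    {q : ℕ} (hq : 0 < q) (hw : 0 ≤ w) (hA : 1 ≤ A) (hswA : s + w / q ≤ A)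
    (hz : ∀ j, ¬ q ∣ j → ‖∑ x, z x ^ j‖ ≤ s) (hz' : ∀ j, ‖∑ x, z x ^ j‖ ≤ s + w) (k : ℕ) :
    ‖MvPolynomial.aeval z (MvPolynomial.esymm σ ℂ k)‖ ≤ multichooseReal A k := by
  induction k using Nat.strong_induction_on with
  | _ k ih =>
    rcases Nat.eq_zero_or_pos k with rfl | hk
    · simp
    have hT := multichooseReal_monotone hA
    have hT0 := multichooseReal_nonneg (zero_le_one.trans hA)
    have hnewton := congrArg (MvPolynomial.aeval z) (MvPolynomial.mul_esymm_eq_sum σ ℂ k)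
    rw [Finset.sum_filter, Finset.Nat.sum_antidiagonal_eq_sum_range_succ_mk,
      Finset.sum_range_succ] at hnewton
    simp only [lt_irrefl, if_false, add_zero] at hnewton
    rw [Finset.sum_congr rfl (fun i hi => if_pos (Finset.mem_range.1 hi))] at hnewton
    simp only [map_mul, map_sum, map_pow, map_neg, map_one, map_natCast, MvPolynomial.psum,
      MvPolynomial.aeval_X] at hnewton
    have hkpos : (0 : ℝ) < k := by exact_mod_cast hk
    refine le_of_mul_le_mul_left ?_ hkpos
    have hnorm := congrArg norm hnewton
    rw [norm_mul, norm_mul, norm_pow, norm_neg, norm_one, one_pow, one_mul,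
      Complex.norm_natCast] at hnorm
    rw [hnorm, mul_multichooseReal]
    calc _ ≤ ∑ i ∈ Finset.range k, multichooseReal A i * (s + if q ∣ k - i then w else 0) := by
          refine norm_sum_le_of_le _ fun i hi => ?_
          rw [norm_mul, norm_mul, norm_pow, norm_neg, norm_one, one_pow, one_mul]
          refine mul_le_mul (ih i (Finset.mem_range.1 hi)) ?_ (norm_nonneg _) (hT0 i)
          split_ifs with h
          · exact hz' _
          · simpa using hz _ h
      _ = s * ∑ i ∈ Finset.range k, multichooseReal A i + w / q *
            (q * ∑ i ∈ (Finset.range k).filter (fun i => q ∣ k - i), multichooseReal A i) := by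
          have : (q : ℝ) ≠ 0 := by positivity
          rw [← mul_assoc, div_mul_cancel₀ _ this, Finset.sum_filter, Finset.mul_sum,
            Finset.mul_sum, ← Finset.sum_add_distrib]
          refine Finset.sum_congr rfl fun i _ => ?_
          split_ifs <;> ring
      _ ≤ s * ∑ i ∈ Finset.range k, multichooseReal A i
            + w / q * ∑ i ∈ Finset.range k, multichooseReal A i := by
          gcongr
          exact mul_sum_filter_dvd_le hT hT0 hq k
      _ ≤ A * ∑ i ∈ Finset.range k, multichooseReal A i := by
          rw [← add_mul]
          exact mul_le_mul_of_nonneg_right hswA (Finset.sum_nonneg fun i _ => hT0 i)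

theorem addChar_map_sum_eq_prod {ι A M : Type*} [AddCommMonoid A] [CommMonoid M]
    (ψ : AddChar A M) (s : Finset ι) (g : ι → A) : ψ (∑ i ∈ s, g i) = ∏ i ∈ s, ψ (g i) := by
  classical
  induction s using Finset.induction_on with
  | empty => simp
  | insert a s ha ih => rw [Finset.sum_insert ha, Finset.prod_insert ha, ψ.map_add_eq_mul, ih]

section MeanValue

variable {F : Type*} [Field F]

theorem aeval_esymm_eq_of_sum_pow_eq {d : ℕ} (hchar : ∀ j : ℕ, 1 ≤ j → j ≤ d → (j : F) ≠ 0)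
    {x y : Fin d → F} (h : ∀ j : Fin d, ∑ i, x i ^ (j + 1 : ℕ) = ∑ i, y i ^ (j + 1 : ℕ))
    (k : ℕ) (hk : k ≤ d) :
    MvPolynomial.aeval x (MvPolynomial.esymm (Fin d) F k)
      = MvPolynomial.aeval y (MvPolynomial.esymm (Fin d) F k) := by
  induction k using Nat.strong_induction_on with
  | _ k ih =>
    rcases Nat.eq_zero_or_pos k with rfl | hk0
    · simp
    have hx := congrArg (MvPolynomial.aeval x) (MvPolynomial.mul_esymm_eq_sum (Fin d) F k)
    have hy := congrArg (MvPolynomial.aeval y) (MvPolynomial.mul_esymm_eq_sum (Fin d) F k)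
    simp only [map_mul, map_sum, map_pow, map_neg, map_one, map_natCast, MvPolynomial.psum,
      MvPolynomial.aeval_X] at hx hy
    refine mul_left_cancel₀ (hchar k hk0 hk) ?_
    rw [hx, hy]
    congr 1
    refine Finset.sum_congr rfl fun a ha => ?_
    rw [Finset.mem_filter, Finset.HasAntidiagonal.mem_antidiagonal] at ha
    rw [ih a.1 ha.2 (by omega)]
    congr 1
    have := h ⟨a.2 - 1, by omega⟩
    simpa [Nat.sub_add_cancel (show 1 ≤ a.2 by omega)] using this

theorem mem_range_of_sum_pow_eq {d : ℕ} (hchar : ∀ j : ℕ, 1 ≤ j → j ≤ d → (j : F) ≠ 0)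
    {x y : Fin d → F} (h : ∀ j : Fin d, ∑ i, x i ^ (j + 1 : ℕ) = ∑ i, y i ^ (j + 1 : ℕ))
    (i : Fin d) : ∃ l, x l = y i := by
  have key : ∀ (z : Fin d → F) (t : F), ∏ l, (t + z l) = ∑ j ∈ Finset.range (d + 1),
      MvPolynomial.aeval z (MvPolynomial.esymm (Fin d) F j) * t ^ (d - j) := by
    intro z t
    have := congrArg (Polynomial.eval₂RingHom (MvPolynomial.aeval z).toRingHom t)
      (MvPolynomial.prod_C_add_X_eq_sum_esymm F (Fin d))
    simpa using this
  have h0 : ∏ l, (-y i + y l) = 0 :=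
    Finset.prod_eq_zero (Finset.mem_univ i) (neg_add_cancel _)
  have h1 : ∏ l, (-y i + x l) = 0 := by
    rw [← h0, key, key]
    refine Finset.sum_congr rfl fun j hj => ?_
    rw [aeval_esymm_eq_of_sum_pow_eq hchar h j (by have := Finset.mem_range.1 hj; omega)]
  obtain ⟨l, -, hl⟩ := Finset.prod_eq_zero_iff.1 h1
  exact ⟨l, by linear_combination hl⟩

variable [Fintype F] [DecidableEq F]

theorem card_sum_pow_eq_le {d : ℕ} (hchar : ∀ j : ℕ, 1 ≤ j → j ≤ d → (j : F) ≠ 0)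
    (x : Fin d → F) :
    (Finset.univ.filter fun y : Fin d → F =>
      ∀ j : Fin d, ∑ i, x i ^ (j + 1 : ℕ) = ∑ i, y i ^ (j + 1 : ℕ)).card ≤ d ^ d := by
  calc _ ≤ (Fintype.piFinset fun _ : Fin d => Finset.univ.image x).card := by
        refine Finset.card_le_card fun y hy => ?_
        rw [Fintype.mem_piFinset]
        intro i
        obtain ⟨l, hl⟩ := mem_range_of_sum_pow_eq hchar (Finset.mem_filter.1 hy).2 i
        exact Finset.mem_image.2 ⟨l, Finset.mem_univ _, hl⟩
    _ = (Finset.univ.image x).card ^ d := by simp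
    _ ≤ d ^ d := Nat.pow_le_pow_left (Finset.card_image_le.trans (by simp)) d

theorem sum_addChar_dotProduct {ψ : AddChar F ℂ} (hψ : ψ ≠ 1) {d : ℕ} (v : Fin d → F) :
    ∑ a : Fin d → F, ψ (∑ j, a j * v j)
      = if ∀ j, v j = 0 then (Fintype.card F : ℂ) ^ d else 0 := by
  let L : (Fin d → F) →+ F :=
    { toFun := fun a => ∑ j, a j * v j
      map_zero' := by simp
      map_add' := fun a b => by simp [add_mul, Finset.sum_add_distrib] }
  split_ifs with hv
  · simp [hv]
  · push Not at hv
    obtain ⟨j, hj⟩ := hv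
    obtain ⟨a, ha⟩ := AddChar.ne_one_iff.1 hψ
    have hne : ψ.compAddMonoidHom L ≠ 0 := by
      rw [AddChar.ne_zero_iff]
      refine ⟨Pi.single j (a / v j), ?_⟩
      have : L (Pi.single j (a / v j)) = a := by
        change ∑ i, (Pi.single j (a / v j) : Fin d → F) i * v i = a
        rw [Finset.sum_eq_single j] <;> simp +contextual [hj]
      rwa [AddChar.compAddMonoidHom_apply, this]
    exact AddChar.sum_eq_zero_iff_ne_zero.2 hne

theorem sum_norm_pow_le {ψ : AddChar F ℂ} (hψ : ψ ≠ 1) {d : ℕ}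
    (hchar : ∀ j : ℕ, 1 ≤ j → j ≤ d → (j : F) ≠ 0) :
    ∑ a : Fin d → F, ‖∑ x, ψ (∑ j, a j * x ^ (j + 1 : ℕ))‖ ^ (2 * d)
      ≤ (d : ℝ) ^ d * (Fintype.card F : ℝ) ^ (2 * d) := by
  have hpow : ∀ a : Fin d → F,
      ((‖∑ x, ψ (∑ j, a j * x ^ (j + 1 : ℕ))‖ ^ (2 * d) : ℝ) : ℂ)
        = ∑ x : Fin d → F, ∑ y : Fin d → F,
          ψ (∑ j : Fin d, a j * (∑ i, x i ^ (j + 1 : ℕ) - ∑ i, y i ^ (j + 1 : ℕ))) := by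
    intro a
    rw [pow_mul, Complex.ofReal_pow, Complex.ofReal_pow, ← Complex.mul_conj', mul_pow, ← map_pow,
      Fintype.sum_pow, map_sum, Finset.sum_mul_sum]
    refine Finset.sum_congr rfl fun x _ => Finset.sum_congr rfl fun y _ => ?_
    rw [← addChar_map_sum_eq_prod, ← addChar_map_sum_eq_prod, ← AddChar.map_neg_eq_conj,
      ← AddChar.map_add_eq_mul]
    simp only [mul_sub, Finset.mul_sum, Finset.sum_sub_distrib]
    rw [← sub_eq_add_neg, Finset.sum_comm,
      Finset.sum_comm (f := fun i j => a j * y i ^ (j + 1 : ℕ))]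
  have hsum : ((∑ a : Fin d → F, ‖∑ x, ψ (∑ j, a j * x ^ (j + 1 : ℕ))‖ ^ (2 * d) : ℝ) : ℂ)
      = ((∑ x : Fin d → F, ((Finset.univ.filter fun y : Fin d → F =>
          ∀ j : Fin d, ∑ i, x i ^ (j + 1 : ℕ) = ∑ i, y i ^ (j + 1 : ℕ)).card : ℝ)
            * (Fintype.card F : ℝ) ^ d : ℝ) : ℂ) := by
    rw [Complex.ofReal_sum, Finset.sum_congr rfl fun a _ => hpow a, Finset.sum_comm]
    push_cast
    refine Finset.sum_congr rfl fun x _ => ?_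
    rw [Finset.sum_comm, Finset.sum_congr rfl fun y _ => sum_addChar_dotProduct hψ _,
      ← Finset.sum_filter]
    simp [sub_eq_zero]
  rw [Complex.ofReal_injective hsum]
  calc _ ≤ ∑ _x : Fin d → F, ((d : ℝ) ^ d * (Fintype.card F : ℝ) ^ d) := by
        refine Finset.sum_le_sum fun x _ => ?_
        gcongr
        exact_mod_cast card_sum_pow_eq_le hchar x
    _ = _ := by
        simp
        ring

open Polynomial in
/-- The coefficients of positive degree of `f (a x + b)`. -/
noncomputable def affineCoeff (d : ℕ) (f : F[X]) (u : F × F) (j : Fin d) : F :=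
  u.1 ^ (j + 1 : ℕ) * (taylor u.2 f).coeff (j + 1)

open Polynomial in
omit [Fintype F] [DecidableEq F] in
theorem eval_mul_add {d : ℕ} {f : F[X]} (hfd : f.natDegree ≤ d) (u : F × F) (x : F) :
    f.eval (u.1 * x + u.2) = f.eval u.2 + ∑ j, affineCoeff d f u j * x ^ (j + 1 : ℕ) := by
  rw [← taylor_eval, eval_eq_sum_range' (n := d + 1) (by rw [natDegree_taylor]; omega),
    Finset.sum_range_succ', ← Fin.sum_univ_eq_sum_range
      (fun i => (taylor u.2 f).coeff (i + 1) * (u.1 * x) ^ (i + 1)), add_comm]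
  simp only [taylor_coeff_zero, pow_zero, mul_one, affineCoeff]
  congr 1
  exact Finset.sum_congr rfl fun j _ => by ring

open Polynomial in
omit [DecidableEq F] in
theorem norm_sum_affineCoeff (ψ : AddChar F ℂ) {d : ℕ} {f : F[X]} (hfd : f.natDegree ≤ d)
    {u : F × F} (hu : u.1 ≠ 0) :
    ‖∑ x, ψ (∑ j, affineCoeff d f u j * x ^ (j + 1 : ℕ))‖ = ‖∑ x, ψ (f.eval x)‖ := by
  have hbij : Function.Bijective fun x : F => u.1 * x + u.2 :=
    (Equiv.addRight u.2).bijective.comp (mulLeft_bijective₀ u.1 hu)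
  rw [← hbij.sum_comp (fun x => ψ (f.eval x))]
  simp only [eval_mul_add hfd, AddChar.map_add_eq_mul]
  rw [← Finset.mul_sum, norm_mul, AddChar.norm_apply, one_mul]

open Polynomial in
omit [Fintype F] [DecidableEq F] in
theorem taylor_coeff_natDegree_sub_one {f : F[X]} {e : ℕ} (hfe : f.natDegree = e + 1) (b : F) :
    (taylor b f).coeff e = f.coeff e + ((e + 1 : ℕ) : F) * f.coeff (e + 1) * b := by
  rw [taylor_coeff, eval_eq_sum_range' (n := 2)]
  · simp [Finset.sum_range_succ, hasseDeriv_coeff, add_comm 1 e]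
  · have := natDegree_hasseDeriv_le f e
    omega

open Polynomial in
theorem card_affineCoeff_fiber_le {d : ℕ} (hchar : ∀ j : ℕ, 1 ≤ j → j ≤ d → (j : F) ≠ 0)
    {f : F[X]} (hf : 2 ≤ f.natDegree) (hfd : f.natDegree ≤ d) (g : Fin d → F) :
    (((Finset.univ.erase (0 : F)) ×ˢ (Finset.univ : Finset F)).filter
      fun u => affineCoeff d f u = g).card ≤ d := by
  obtain ⟨e, he⟩ := Nat.exists_eq_add_of_le' hf
  have hlead : f.coeff (e + 2) ≠ 0 := by
    rw [← he, coeff_natDegree, Ne, leadingCoeff_eq_zero]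
    rintro rfl
    simp at hf
  let P : F[X] := C (f.coeff (e + 2)) * X ^ (e + 2) - C (g ⟨e + 1, by omega⟩)
  have hP : P.natDegree = e + 2 := by
    rw [natDegree_sub_C, natDegree_C_mul_X_pow _ _ hlead]
  have hP0 : P ≠ 0 := by
    intro h
    simp [h] at hP
  calc _ ≤ P.roots.toFinset.card := by
        refine Finset.card_le_card_of_injOn Prod.fst ?_ ?_
        · intro u hu
          rw [Finset.mem_coe, Finset.mem_filter] at hu
          rw [Finset.mem_coe, Multiset.mem_toFinset, mem_roots hP0, IsRoot]
          have htop : (taylor u.2 f).coeff (e + 1 + 1) = f.coeff (e + 2) := by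
            rw [← he, coeff_taylor_natDegree, coeff_natDegree]
          have hg := congrFun hu.2 ⟨e + 1, by omega⟩
          simp only [affineCoeff, htop] at hg
          simp only [P, eval_sub, eval_mul, eval_C, eval_pow, eval_X]
          rw [← hg]
          ring
        · rintro ⟨a, b⟩ hu ⟨a', b'⟩ hu' (rfl : a = a')
          rw [Finset.mem_coe, Finset.mem_filter] at hu hu'
          have ha : a ≠ 0 := by simpa using hu.1
          have h := congrFun (hu.2.trans hu'.2.symm) ⟨e, by omega⟩
          simp only [affineCoeff] at h
          have h := mul_left_cancel₀ (pow_ne_zero _ ha) h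
          rw [taylor_coeff_natDegree_sub_one he, taylor_coeff_natDegree_sub_one he] at h
          have h := mul_left_cancel₀
            (mul_ne_zero (hchar (e + 1 + 1) (by omega) (by omega)) hlead) (add_left_cancel h)
          rw [h]
    _ ≤ P.natDegree := (Multiset.toFinset_card_le _).trans (card_roots' P)
    _ ≤ d := by omega

open Polynomial in
/-- **Mordell's bound** for complete exponential sums over a finite field. -/
theorem sq_card_mul_norm_sum_pow_le {ψ : AddChar F ℂ} (hψ : ψ ≠ 1) {d : ℕ}
    (hchar : ∀ j : ℕ, 1 ≤ j → j ≤ d → (j : F) ≠ 0) {f : F[X]} (hf : 1 ≤ f.natDegree)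
    (hfd : f.natDegree ≤ d) :
    (Fintype.card F : ℝ) ^ 2 * ‖∑ x, ψ (f.eval x)‖ ^ (2 * d)
      ≤ 2 * d ^ (d + 1) * (Fintype.card F : ℝ) ^ (2 * d) := by
  rcases hf.eq_or_lt with hf1 | hf2
  · obtain ⟨a, ha, b, rfl⟩ := natDegree_eq_one.1 hf1.symm
    have : ∑ x, ψ ((C a * X + C b).eval x) = 0 := by
      have h0 := AddChar.sum_eq_zero_of_ne_one (AddChar.IsPrimitive.of_ne_one hψ ha)
      simp only [AddChar.mulShift_apply] at h0
      simp only [eval_add, eval_mul, eval_C, eval_X, AddChar.map_add_eq_mul]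
      rw [← Finset.sum_mul, h0, zero_mul]
    rw [this, norm_zero, zero_pow (by omega), mul_zero]
    positivity
  · set S := (Finset.univ.erase (0 : F)) ×ˢ (Finset.univ : Finset F)
    have hcardF : (2 : ℝ) ≤ Fintype.card F := by
      exact_mod_cast Fintype.one_lt_card (α := F)
    have hS : ((S.card : ℕ) : ℝ) = (Fintype.card F - 1) * Fintype.card F := by
      rw [Finset.card_product, Finset.card_erase_of_mem (Finset.mem_univ _), Finset.card_univ,
        Nat.cast_mul, Nat.cast_sub Fintype.card_pos, Nat.cast_one]
    have hSle : (S.card : ℝ) ≤ d * (S.image (affineCoeff d f)).card := by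
      exact_mod_cast Finset.card_le_mul_card_image S d
        fun g _ => card_affineCoeff_fiber_le hchar hf2 hfd g
    have himage : (S.image (affineCoeff d f)).card * ‖∑ x, ψ (f.eval x)‖ ^ (2 * d)
        ≤ (d : ℝ) ^ d * (Fintype.card F : ℝ) ^ (2 * d) := by
      refine le_trans ?_ (sum_norm_pow_le hψ hchar)
      rw [← nsmul_eq_mul, ← Finset.sum_const]
      refine (Finset.sum_le_sum fun g hg => le_of_eq ?_).trans
        (Finset.sum_le_univ_sum_of_nonneg fun g => by positivity)
      obtain ⟨u, hu, rfl⟩ := Finset.mem_image.1 hg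
      rw [norm_sum_affineCoeff ψ hfd]
      simpa [S] using hu
    have hnn : 0 ≤ ‖∑ x, ψ (f.eval x)‖ ^ (2 * d) := by positivity
    calc _ ≤ 2 * (S.card : ℝ) * ‖∑ x, ψ (f.eval x)‖ ^ (2 * d) := by
          refine mul_le_mul_of_nonneg_right ?_ hnn
          rw [hS]
          nlinarith
      _ ≤ 2 * (d * (S.image (affineCoeff d f)).card) * ‖∑ x, ψ (f.eval x)‖ ^ (2 * d) := by
          gcongr
      _ = 2 * d * ((S.image (affineCoeff d f)).card * ‖∑ x, ψ (f.eval x)‖ ^ (2 * d)) := by ring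
      _ ≤ 2 * d * ((d : ℝ) ^ d * (Fintype.card F : ℝ) ^ (2 * d)) := by gcongr
      _ = _ := by ring

end MeanValue

theorem le_exp_mul_of_sq_mul_pow_le {q S : ℝ} (hq : 0 < q) (hS : 0 ≤ S) {d : ℕ} (hd : 1 ≤ d)
    (h : q ^ 2 * S ^ (2 * d) ≤ 2 * d ^ (d + 1) * q ^ (2 * d)) :
    S ≤ Real.exp (1.85 * d) * q * q ^ (-(1 : ℝ) / d) := by
  have hd1 : (1 : ℝ) ≤ d := by exact_mod_cast hd
  have hd0 : (d : ℝ) ≠ 0 := by positivity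
  have hr : (q ^ (-(1 : ℝ) / d)) ^ (2 * d) * q ^ 2 = 1 := by
    rw [← Real.rpow_natCast, ← Real.rpow_mul hq.le, ← Real.rpow_natCast q 2, ← Real.rpow_add hq]
    push_cast
    rw [show -(1 : ℝ) / d * (2 * d) + 2 = 0 by field_simp; ring, Real.rpow_zero]
  have hconst : (2 : ℝ) * d ^ (d + 1) ≤ Real.exp (1.85 * d) ^ (2 * d) := by
    have h1 : (2 * d : ℝ) ≤ Real.exp (2 * d) := by linarith [Real.add_one_le_exp (2 * d : ℝ)]
    have h2 : (d : ℝ) ≤ Real.exp d := by linarith [Real.add_one_le_exp (d : ℝ)]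
    calc (2 : ℝ) * d ^ (d + 1) = (2 * d) * d ^ d := by ring
      _ ≤ Real.exp (2 * d) * Real.exp d ^ d := by gcongr
      _ = Real.exp (2 * d + d * d) := by rw [← Real.exp_nat_mul, ← Real.exp_add]
      _ ≤ Real.exp ((2 * d : ℕ) * (1.85 * d)) := by
          apply Real.exp_le_exp.2
          push_cast
          nlinarith
      _ = _ := by rw [Real.exp_nat_mul]
  refine (pow_le_pow_iff_left₀ hS (by positivity) (by omega : 2 * d ≠ 0)).1 ?_
  refine le_of_mul_le_mul_left (h.trans ?_) (by positivity : 0 < q ^ 2)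
  calc 2 * (d : ℝ) ^ (d + 1) * q ^ (2 * d) ≤ Real.exp (1.85 * d) ^ (2 * d) * q ^ (2 * d) := by
        gcongr
    _ = Real.exp (1.85 * d) ^ (2 * d) * q ^ (2 * d) * ((q ^ (-(1 : ℝ) / d)) ^ (2 * d) * q ^ 2) := by
        rw [hr, mul_one]
    _ = _ := by ring

section ZModSums

open Polynomial

/-- The polynomial `g` with `f (a + N x) = f a + N g(x)`. -/
noncomputable def shiftQuotient (f : ℤ[X]) (a N : ℤ) : ℤ[X] :=
  X * (divX (taylor a f)).comp (C N * X)

theorem taylor_comp_C_mul_X (f : ℤ[X]) (a N : ℤ) :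
    (taylor a f).comp (C N * X) = C N * shiftQuotient f a N + C (f.eval a) := by
  conv_lhs => rw [← divX_mul_X_add (taylor a f)]
  simp only [add_comp, mul_comp, X_comp, C_comp, taylor_coeff_zero, shiftQuotient]
  ring

theorem eval_add_mul (f : ℤ[X]) (a N z : ℤ) :
    f.eval (a + N * z) = f.eval a + N * (shiftQuotient f a N).eval z := by
  have h := congrArg (eval z) (taylor_comp_C_mul_X f a N)
  simp only [eval_comp, eval_mul, eval_C, eval_X, eval_add, taylor_eval] at h
  rw [add_comm a, h, add_comm]

theorem natDegree_map_shiftQuotient {F : Type*} [Field F] (φ : ℤ →+* F) (f : ℤ[X]) (a : ℤ)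
    {N : ℤ} (hN : φ N ≠ 0) :
    ((shiftQuotient f a N).map φ).natDegree = (f.map φ).natDegree := by
  have h := congrArg (fun g => (g.map φ).natDegree) (taylor_comp_C_mul_X f a N)
  simp only [Polynomial.map_add, Polynomial.map_mul, map_C, natDegree_add_C,
    natDegree_C_mul hN, Polynomial.map_comp, map_X, natDegree_comp, map_taylor,
    natDegree_taylor, natDegree_X, mul_one] at h
  exact h.symm

theorem eval_map_shiftQuotient_of_eq_zero {F : Type*} [Field F] (φ : ℤ →+* F) (f : ℤ[X])
    (a : ℤ) {N : ℤ} (hN : φ N = 0) (z : F) :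
    ((shiftQuotient f a N).map φ).eval z = (f.map φ).derivative.eval (φ a) * z := by
  have : φ ((divX (taylor a f)).coeff 0) = (f.map φ).derivative.eval (φ a) := by
    rw [coeff_divX, zero_add, taylor_coeff_one, derivative_map, eval_map_apply]
  rw [shiftQuotient, Polynomial.map_mul, map_X, Polynomial.map_comp, Polynomial.map_mul, map_C, hN,
    C_0, zero_mul, comp_zero, eval_mul, eval_X, eval_C, ← coeff_zero_eq_eval_zero, coeff_map, this,
    mul_comm]

theorem one_le_natDegree_map {F : Type*} [Field F] (φ : ℤ →+* F) {f : ℤ[X]} {i : ℕ}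
    (hi : 1 ≤ i) (hfi : φ (f.coeff i) ≠ 0) : 1 ≤ (f.map φ).natDegree :=
  hi.trans (le_natDegree_of_ne_zero (by rwa [coeff_map]))

theorem card_filter_val_cast_le {n q : ℕ} [NeZero n] [NeZero q] (hqn : q ∣ n)
    (T : Finset (ZMod q)) :
    ((Finset.univ : Finset (ZMod n)).filter fun x => (x.val : ZMod q) ∈ T).card
      ≤ n / q * T.card := by
  refine Finset.card_le_mul_card_image_of_maps_to (f := fun x : ZMod n => (x.val : ZMod q))
    (fun x hx => (Finset.mem_filter.1 hx).2) _ fun a _ => ?_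
  calc _ ≤ (Finset.range (n / q)).card := by
        refine Finset.card_le_card_of_injOn (fun x : ZMod n => x.val / q) ?_ ?_
        · intro x _
          exact Finset.mem_coe.2 (Finset.mem_range.2
            (Nat.div_lt_div_of_lt_of_dvd hqn (ZMod.val_lt x)))
        · intro x hx y hy hxy
          have hx := (Finset.mem_filter.1 (Finset.mem_coe.1 hx)).2
          have hy := (Finset.mem_filter.1 (Finset.mem_coe.1 hy)).2
          have hmod : x.val % q = y.val % q :=
            (ZMod.natCast_eq_natCast_iff' _ _ _).1 (hx.trans hy.symm)
          refine ZMod.val_injective n ?_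
          rw [← Nat.div_add_mod x.val q, ← Nat.div_add_mod y.val q, hmod]
          simp only at hxy
          rw [hxy]
    _ = n / q := Finset.card_range _

/-- A nontrivial character of `ℤ/nℤ` restricts to a nontrivial character of prime order. -/
theorem exists_prime_char {n : ℕ} [NeZero n] {ψ : AddChar (ZMod n) ℂ} (hψ : ψ ≠ 1) :
    ∃ (q N : ℕ) (χ : AddChar (ZMod q) ℂ), q.Prime ∧ q ∣ n ∧ χ ≠ 1 ∧
      ∀ z : ℤ, ψ ((N * z : ℤ) : ZMod n) = χ z := by
  have hn : ψ ^ n = 1 := by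
    ext x
    rw [AddChar.pow_apply, ← AddChar.map_nsmul_eq_pow]
    simp
  have hM : orderOf ψ ≠ 1 := by rwa [Ne, orderOf_eq_one_iff]
  have hMn : orderOf ψ ∣ n := orderOf_dvd_of_pow_eq_one hn
  obtain ⟨q, hq, N, hN⟩ := Nat.exists_prime_and_dvd hM
  have : NeZero q := ⟨hq.ne_zero⟩
  have hN0 : 0 < N := by
    rcases Nat.eq_zero_or_pos N with rfl | h
    · rw [mul_zero] at hN
      exact absurd (Nat.eq_zero_of_zero_dvd (hN ▸ hMn)) (NeZero.ne n)
    · exact h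
  have hζ : (ψ N) ^ q = 1 := by
    have := congrArg (fun χ : AddChar (ZMod n) ℂ => χ 1) (pow_orderOf_eq_one ψ)
    rw [hN] at this
    rw [← AddChar.map_nsmul_eq_pow]
    simp only [AddChar.pow_apply, ← AddChar.map_nsmul_eq_pow, AddChar.one_apply] at this
    rw [← this]
    congr 1
    simp
  have hζ1 : ψ N ≠ 1 := by
    intro h
    have hpow : ψ ^ N = 1 := by
      ext x
      rw [AddChar.pow_apply, ← AddChar.map_nsmul_eq_pow, AddChar.one_apply]
      rw [← ZMod.natCast_zmod_val x, nsmul_eq_mul, mul_comm, ← nsmul_eq_mul,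
        AddChar.map_nsmul_eq_pow, h, one_pow]
    have := Nat.le_of_dvd hN0 (orderOf_dvd_of_pow_eq_one hpow)
    rw [hN] at this
    nlinarith [hq.two_le]
  have hχ1 : AddChar.zmodChar q hζ 1 = ψ N := by
    simpa using AddChar.zmodChar_apply' hζ 1
  refine ⟨q, N, AddChar.zmodChar q hζ, hq, (Dvd.intro _ hN.symm).trans hMn, ?_, fun z => ?_⟩
  · rw [AddChar.zmod_char_ne_one_iff, hχ1]
    exact hζ1
  · have h1 : ((N * z : ℤ) : ZMod n) = z • (N : ZMod n) := by simp [mul_comm]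
    have h2 : (z : ZMod q) = z • (1 : ZMod q) := by simp
    rw [h1, h2, AddChar.map_zsmul_eq_zpow, AddChar.map_zsmul_eq_zpow, hχ1]

theorem mul_norm_sum_le_sum_norm {n q N : ℕ} [NeZero n] [NeZero q] {ψ : AddChar (ZMod n) ℂ}
    {χ : AddChar (ZMod q) ℂ} (hχ : ∀ z : ℤ, ψ ((N * z : ℤ) : ZMod n) = χ z) (f : ℤ[X]) :
    q * ‖∑ x, ψ ((f.map (Int.castRingHom (ZMod n))).eval x)‖
      ≤ ∑ x : ZMod n, ‖∑ z, χ (((shiftQuotient f x.val N).map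
          (Int.castRingHom (ZMod q))).eval z)‖ := by
  set g := f.map (Int.castRingHom (ZMod n))
  have hcast : ∀ (m : ℕ) (h : ℤ[X]) (z : ℤ),
      (h.map (Int.castRingHom (ZMod m))).eval (z : ZMod m) = ((h.eval z : ℤ) : ZMod m) :=
    fun m h z => by simp
  have hterm : ∀ (x : ZMod n) (z : ZMod q), ψ (g.eval (x + N * z.val)) = ψ (g.eval x) *
      χ (((shiftQuotient f x.val N).map (Int.castRingHom (ZMod q))).eval z) := by
    intro x z
    have hx : ((x.val : ℤ) : ZMod n) = x := by simp
    have hz : ((z.val : ℤ) : ZMod q) = z := by simp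
    have hxz : x + N * z.val = (((x.val : ℤ) + N * (z.val : ℤ) : ℤ) : ZMod n) := by simp
    rw [hxz, hcast, eval_add_mul, Int.cast_add, AddChar.map_add_eq_mul, hχ, ← hcast, ← hcast,
      hx, hz]
  have hshift : (q : ℂ) * ∑ x, ψ (g.eval x)
      = ∑ x, ∑ z : ZMod q, ψ (g.eval (x + N * z.val)) := by
    have hz : ∀ z : ZMod q, ∑ x, ψ (g.eval (x + N * z.val)) = ∑ x, ψ (g.eval x) := fun z =>
      Equiv.sum_comp (Equiv.addRight ((N : ZMod n) * (z.val : ZMod n))) fun x => ψ (g.eval x)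
    rw [Finset.sum_comm, Finset.sum_congr rfl fun z _ => hz z]
    simp
  rw [← Complex.norm_natCast, ← norm_mul, hshift]
  refine norm_sum_le_of_le _ fun x _ => le_of_eq ?_
  rw [Finset.sum_congr rfl fun z _ => hterm x z, ← Finset.mul_sum, norm_mul, AddChar.norm_apply,
    one_mul]

/-- Complete exponential sums over `ℤ/nℤ` save a factor `p ^ (1 / d)`, where `p` is the least
prime factor of `n`. -/
theorem norm_sum_zmod_le {n : ℕ} [NeZero n] {ψ : AddChar (ZMod n) ℂ} (hψ : ψ ≠ 1)
    {f : ℤ[X]} {d : ℕ} (hfd : f.natDegree ≤ d) (hdn : d < n.minFac)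
    (hf : ∀ q : ℕ, q.Prime → q ∣ n → ∃ i, 1 ≤ i ∧ i ≤ d ∧ (f.coeff i : ZMod q) ≠ 0) :
    ‖∑ x, ψ ((f.map (Int.castRingHom (ZMod n))).eval x)‖
      ≤ Real.exp (1.85 * d) * n * (n.minFac : ℝ) ^ (-(1 : ℝ) / d) := by
  obtain ⟨q, N, χ, hq, hqn, hχ1, hχ⟩ := exists_prime_char hψ
  have : Fact q.Prime := ⟨hq⟩
  have : NeZero q := ⟨hq.ne_zero⟩
  have hpq : n.minFac ≤ q := Nat.minFac_le_of_dvd hq.two_le hqn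
  have hq0 : (0 : ℝ) < q := by exact_mod_cast hq.pos
  have hp0 : (0 : ℝ) < n.minFac := by exact_mod_cast n.minFac_pos
  set φ := Int.castRingHom (ZMod q)
  obtain ⟨i, hi1, hid, hi⟩ := hf q hq hqn
  have hd : 1 ≤ d := hi1.trans hid
  have hdeg : 1 ≤ (f.map φ).natDegree := one_le_natDegree_map φ hi1 hi
  have hdegd : (f.map φ).natDegree ≤ d := natDegree_map_le.trans hfd
  have hchar : ∀ j : ℕ, 1 ≤ j → j ≤ d → (j : ZMod q) ≠ 0 := by
    intro j h1 h2 h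
    have := Nat.le_of_dvd h1 ((ZMod.natCast_eq_zero_iff j q).1 h)
    omega
  have hmain : q * ‖∑ x, ψ ((f.map (Int.castRingHom (ZMod n))).eval x)‖
      ≤ n * (Real.exp (1.85 * d) * q * (q : ℝ) ^ (-(1 : ℝ) / d)) := by
    refine (mul_norm_sum_le_sum_norm hχ f).trans ?_
    by_cases hN : φ N = 0
    · have hder : (f.map φ).derivative ≠ 0 := by
        intro h
        have := congrArg (fun g => g.coeff ((f.map φ).natDegree - 1)) h
        simp only [coeff_derivative, coeff_zero, Nat.sub_add_cancel hdeg, coeff_natDegree] at this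
        rcases mul_eq_zero.1 this with h0 | h0
        · rw [leadingCoeff_eq_zero] at h0
          simp [h0] at hdeg
        · refine hchar _ hdeg hdegd ?_
          rw [← Nat.sub_add_cancel hdeg]
          exact_mod_cast h0
      have hinner : ∀ x : ZMod n,
          ‖∑ z, χ (((shiftQuotient f x.val N).map φ).eval z)‖
            = if (x.val : ZMod q) ∈ (f.map φ).derivative.roots.toFinset then (q : ℝ) else 0 := by
        intro x
        simp only [eval_map_shiftQuotient_of_eq_zero φ f _ hN]
        have hx : φ (x.val : ℤ) = (x.val : ZMod q) := by simp [φ]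
        rw [hx]
        have hmem : (x.val : ZMod q) ∈ (f.map φ).derivative.roots.toFinset ↔
            (f.map φ).derivative.eval (x.val : ZMod q) = 0 := by
          rw [Multiset.mem_toFinset, mem_roots hder, IsRoot]
        split_ifs with h
        · rw [hmem.1 h]
          simp [ZMod.card]
        · have h0 := AddChar.sum_eq_zero_of_ne_one
            (AddChar.IsPrimitive.of_ne_one hχ1 (mt hmem.2 h))
          simp only [AddChar.mulShift_apply] at h0
          rw [h0, norm_zero]
      rw [Finset.sum_congr rfl fun x _ => hinner x, ← Finset.sum_filter, Finset.sum_const,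
        nsmul_eq_mul]
      have hroots : (f.map φ).derivative.roots.toFinset.card ≤ d :=
        (Multiset.toFinset_card_le _).trans ((card_roots' _).trans
          ((natDegree_derivative_le _).trans (by omega)))
      have hcount : ((Finset.univ : Finset (ZMod n)).filter fun x =>
          (x.val : ZMod q) ∈ (f.map φ).derivative.roots.toFinset).card * q ≤ n * d := by
        calc _ ≤ n / q * d * q := Nat.mul_le_mul_right q
              ((card_filter_val_cast_le hqn _).trans (Nat.mul_le_mul_left _ hroots))
          _ = n / q * q * d := by ring
          _ = n * d := by rw [Nat.div_mul_cancel hqn]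
      have hcount' : (((Finset.univ : Finset (ZMod n)).filter fun x =>
          (x.val : ZMod q) ∈ (f.map φ).derivative.roots.toFinset).card * q : ℝ) ≤ n * d := by
        exact_mod_cast hcount
      refine hcount'.trans ?_
      have hd1 : (1 : ℝ) ≤ d := by exact_mod_cast hd
      have h1 : (d : ℝ) ≤ Real.exp (1.85 * d) := by
        linarith [Real.add_one_le_exp (1.85 * d : ℝ)]
      have h2 : (1 : ℝ) ≤ q * (q : ℝ) ^ (-(1 : ℝ) / d) := by
        have hone : (1 : ℝ) / d ≤ 1 := (div_le_one (by positivity)).2 hd1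
        calc (1 : ℝ) ≤ (q : ℝ) ^ (1 + -(1 : ℝ) / d) :=
              Real.one_le_rpow (by exact_mod_cast hq.one_lt.le) (by rw [neg_div]; linarith)
          _ = _ := by rw [Real.rpow_add hq0, Real.rpow_one]
      rw [mul_assoc (Real.exp _)]
      gcongr
      nlinarith [Real.exp_pos (1.85 * d : ℝ)]
    · have hinner : ∀ x : ZMod n,
          ‖∑ z, χ (((shiftQuotient f x.val N).map φ).eval z)‖
            ≤ Real.exp (1.85 * d) * q * (q : ℝ) ^ (-(1 : ℝ) / d) := by
        intro x
        refine le_exp_mul_of_sq_mul_pow_le hq0 (norm_nonneg _) hd ?_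
        have hdeg' := natDegree_map_shiftQuotient φ f x.val hN
        have h := sq_card_mul_norm_sum_pow_le hχ1 hchar (hdeg'.symm ▸ hdeg) (hdeg'.symm ▸ hdegd)
        rwa [ZMod.card] at h
      refine (Finset.sum_le_sum fun x _ => hinner x).trans (le_of_eq ?_)
      simp [ZMod.card]
  have hle : ‖∑ x, ψ ((f.map (Int.castRingHom (ZMod n))).eval x)‖
      ≤ Real.exp (1.85 * d) * n * (q : ℝ) ^ (-(1 : ℝ) / d) := by
    refine le_of_mul_le_mul_left (hmain.trans (le_of_eq ?_)) hq0
    ring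
  refine hle.trans ?_
  refine mul_le_mul_of_nonneg_left ?_ (by positivity)
  refine Real.rpow_le_rpow_of_nonpos hp0 (by exact_mod_cast hpq) ?_
  rw [neg_div, neg_nonpos]
  positivity

end ZModSums

theorem one_div_minFac_le_deltaMoebius {n : ℕ} (hn : 2 ≤ n) :
    1 / (n.minFac : ℝ) ≤ deltaMoebius n := by
  unfold deltaMoebius
  refine Finset.single_le_sum (f := fun i : ℕ => (1 : ℝ) / i) (fun i _ => by positivity) ?_
  rw [Finset.mem_filter, Nat.mem_divisors]
  exact ⟨⟨n.minFac_dvd, by omega⟩,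
    ArithmeticFunction.moebius_apply_prime (Nat.minFac_prime (by omega))⟩

theorem natCast_lt_of_exp_mul_rpow_le_one {p : ℝ} (hp : 0 < p) {d : ℕ} (hd : 1 ≤ d)
    (h : Real.exp (1.85 * d) * p ^ (-(1 : ℝ) / d) ≤ 1) : (d : ℝ) < p := by
  have hd1 : (1 : ℝ) ≤ d := by exact_mod_cast hd
  have hpow := pow_le_one₀ (n := d) (by positivity) h
  have hr : (p ^ (-(1 : ℝ) / d)) ^ d * p = 1 := by
    rw [← Real.rpow_natCast, ← Real.rpow_mul hp.le, div_mul_cancel₀ _ (by positivity),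
      Real.rpow_neg_one, inv_mul_cancel₀ hp.ne']
  have hexp : Real.exp (1.85 * d) ^ d ≤ p := by
    calc Real.exp (1.85 * d) ^ d
        = (Real.exp (1.85 * d) * p ^ (-(1 : ℝ) / d)) ^ d * p := by
          rw [mul_pow, mul_assoc, hr, mul_one]
      _ ≤ 1 * p := by gcongr
      _ = p := one_mul p
  have h1 : Real.exp (1.85 * d) ≤ Real.exp (1.85 * d) ^ d :=
    le_self_pow₀ (Real.one_le_exp (by positivity)) (by omega)
  linarith [Real.add_one_le_exp (1.85 * d : ℝ)]

theorem card_mul_polySubsetSumCount {R : Type*} [CommRing R] [Fintype R] [DecidableEq R]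
    (D : Finset R) (f : Polynomial R) (k : ℕ) (b : R) :
    (Fintype.card R : ℂ) * polySubsetSumCount D f k b
      = ∑ ψ : AddChar R ℂ, ψ (-b) * ∑ S ∈ D.powersetCard k, ∏ x ∈ S, ψ (f.eval x) := by
  simp only [Finset.mul_sum]
  rw [Finset.sum_comm, polySubsetSumCount, Finset.card_filter, Nat.cast_sum, Finset.mul_sum]
  refine Finset.sum_congr rfl fun S _ => ?_
  have h : ∀ ψ : AddChar R ℂ, ψ (-b) * ∏ x ∈ S, ψ (f.eval x) = ψ (-b + ∑ x ∈ S, f.eval x) := by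
    intro ψ
    rw [AddChar.map_add_eq_mul, addChar_map_sum_eq_prod]
  rw [Finset.sum_congr rfl fun ψ _ => h ψ, AddChar.sum_apply_eq_ite]
  simp only [neg_add_eq_zero, eq_comm (a := b)]
  split_ifs <;> simp

theorem abs_polySubsetSumCount_sub_le {R : Type*} [CommRing R] [Fintype R] [DecidableEq R]
    (D : Finset R) (f : Polynomial R) (k : ℕ) (b : R) {T : ℝ}
    (hT : ∀ ψ : AddChar R ℂ, ψ ≠ 1 → ‖∑ S ∈ D.powersetCard k, ∏ x ∈ S, ψ (f.eval x)‖ ≤ T)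
    (hT0 : 0 ≤ T) :
    |(polySubsetSumCount D f k b : ℝ) - 1 / Fintype.card R * (D.card.choose k : ℝ)| ≤ T := by
  classical
  have hcard : (0 : ℝ) < Fintype.card R := by exact_mod_cast Fintype.card_pos
  have hsum := card_mul_polySubsetSumCount D f k b
  rw [← Finset.add_sum_erase _ _ (Finset.mem_univ (1 : AddChar R ℂ))] at hsum
  simp only [AddChar.one_apply, Finset.prod_const_one, Finset.sum_const,
    Finset.card_powersetCard, nsmul_eq_mul, mul_one, one_mul] at hsum
  have hdiff : ((Fintype.card R * ((polySubsetSumCount D f k b : ℝ)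
      - 1 / Fintype.card R * (D.card.choose k : ℝ)) : ℝ) : ℂ)
      = ∑ ψ ∈ Finset.univ.erase (1 : AddChar R ℂ),
        ψ (-b) * ∑ S ∈ D.powersetCard k, ∏ x ∈ S, ψ (f.eval x) := by
    rw [mul_sub, ← mul_assoc, mul_one_div_cancel hcard.ne', one_mul]
    push_cast
    rw [hsum, add_sub_cancel_left]
  refine le_of_mul_le_mul_left ?_ hcard
  calc (Fintype.card R : ℝ) * _ = ‖((Fintype.card R * ((polySubsetSumCount D f k b : ℝ)
      - 1 / Fintype.card R * (D.card.choose k : ℝ)) : ℝ) : ℂ)‖ := by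
        rw [Complex.norm_real, norm_mul, Real.norm_eq_abs, Real.norm_eq_abs, abs_of_pos hcard]
    _ ≤ ∑ ψ ∈ Finset.univ.erase (1 : AddChar R ℂ), T := by
        rw [hdiff]
        refine norm_sum_le_of_le _ fun ψ hψ => ?_
        rw [norm_mul, AddChar.norm_apply, one_mul]
        exact hT ψ (Finset.ne_of_mem_erase hψ)
    _ ≤ ∑ ψ : AddChar R ℂ, T :=
        Finset.sum_le_sum_of_subset_of_nonneg (Finset.erase_subset _ _) fun _ _ _ => hT0
    _ = Fintype.card R * T := by
        rw [Finset.sum_const, Finset.card_univ, AddChar.card_eq, nsmul_eq_mul]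

theorem sum_powersetCard_prod_eq_aeval_esymm {α : Type*} (D : Finset α) (g : α → ℂ) (k : ℕ) :
    ∑ S ∈ D.powersetCard k, ∏ x ∈ S, g x
      = MvPolynomial.aeval (fun x : D => g x) (MvPolynomial.esymm D ℂ k) := by
  rw [MvPolynomial.aeval_esymm_eq_multiset_esymm, ← Finset.esymm_map_val]
  congr 1
  exact (Multiset.attach_map_val' D.val g).symm

theorem norm_sum_powersetCard_le {R : Type*} [CommRing R] [Fintype R] [DecidableEq R]
    (D : Finset R) (g : R → R) {B A : ℝ} {p : ℕ} (hp : 0 < p)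
    (hB : ∀ ψ : AddChar R ℂ, ψ ≠ 1 → ‖∑ x, ψ (g x)‖ ≤ B)
    (hcard : ∀ ψ : AddChar R ℂ, ψ ≠ 1 → p ≤ orderOf ψ)
    (hBD : B + (Dᶜ).card ≤ D.card)
    (hA : 1 ≤ A) (hBA : B + (Dᶜ).card + (D.card - (B + (Dᶜ).card)) / p ≤ A)
    {ψ : AddChar R ℂ} (hψ : ψ ≠ 1) (k : ℕ) :
    ‖∑ S ∈ D.powersetCard k, ∏ x ∈ S, ψ (g x)‖ ≤ multichooseReal A k := by
  rw [sum_powersetCard_prod_eq_aeval_esymm D (fun x => ψ (g x))]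
  have hsum : ∀ j : ℕ, ∑ x : D, ψ (g x) ^ j = ∑ x ∈ D, (ψ ^ j) (g x) := fun j =>
    Finset.sum_coe_sort D fun x => ψ (g x) ^ j
  have hnorm : ∀ (χ : AddChar R ℂ) (E : Finset R), ‖∑ x ∈ E, χ (g x)‖ ≤ E.card := by
    intro χ E
    calc ‖∑ x ∈ E, χ (g x)‖ ≤ ∑ x ∈ E, ‖χ (g x)‖ := norm_sum_le _ _
      _ = E.card := by simp [AddChar.norm_apply]
  have hp' : (0 : ℝ) < p := by exact_mod_cast hp
  have hpo : (p : ℝ) ≤ orderOf ψ := by exact_mod_cast hcard ψ hψ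
  refine norm_esymm_le _ (s := B + (Dᶜ).card) (q := orderOf ψ)
    (hp.trans_le (hcard ψ hψ)) (sub_nonneg.2 hBD) hA (le_trans ?_ hBA)
    (fun j hj => ?_) (fun j => ?_) k
  · have := sub_nonneg.2 hBD
    gcongr
  · rw [hsum]
    have hχ : ψ ^ j ≠ 1 := mt orderOf_dvd_of_pow_eq_one hj
    have h := Finset.sum_add_sum_compl D fun x => (ψ ^ j) (g x)
    rw [← eq_sub_iff_add_eq] at h
    rw [h]
    exact (norm_sub_le _ _).trans (add_le_add (hB _ hχ) (hnorm _ _))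
  · rw [hsum, add_sub_cancel]
    exact hnorm _ _

/-- **Theorem (polynomial subset sums over `ℤ/nℤ`).**
Let `p` be the smallest prime divisor of `n ≥ 2`, let `f ∈ ℤ[x]` have degree `d ≥ 1`
with `gcd(a_d, …, a_1, n) = 1`, and `C_d = e^{1.85d}`. If `D ⊆ ℤ/nℤ` with
`|D| = n - c ≥ C_d·n·p^{-1/d} + c`, then for all `b` and `0 ≤ k ≤ |D|`,
`|N_f(D,k,b) - (1/n)·C(n-c,k)| ≤ C(δ(n)(n-c) + (1-δ(n))(C_d·n·p^{-1/d} + c) + k - 1, k)`. -/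
theorem polySubsetSum_asymptotic_ZMod
    (n : ℕ) (hn : 2 ≤ n) (f : Polynomial ℤ) (d : ℕ) (hdeg : f.natDegree = d) (hd : 1 ≤ d)
    (hgcd : Nat.gcd ((Finset.Icc 1 d).gcd fun i => (f.coeff i).natAbs) n = 1)
    (D : Finset (ZMod n)) (c : ℕ) (hD : (D.card : ℝ) = (n : ℝ) - c)
    (hbig : (n : ℝ) - c ≥
      Real.exp (1.85 * d) * n * ((n.minFac : ℝ) ^ (-(1 : ℝ) / d)) + c)
    (b : ZMod n) (k : ℕ) (hk : k ≤ D.card) :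
    |(polySubsetSumCount D (f.map (Int.castRingHom (ZMod n))) k b : ℝ)
        - (1 / (n : ℝ)) * realChoose ((n : ℝ) - c) k|
      ≤ realChoose
          (deltaMoebius n * ((n : ℝ) - c)
            + (1 - deltaMoebius n) *
                (Real.exp (1.85 * d) * n * ((n.minFac : ℝ) ^ (-(1 : ℝ) / d)) + c)
            + k - 1) k := by
  have : NeZero n := ⟨by omega⟩
  set p := n.minFac
  set B := Real.exp (1.85 * d) * n * (p : ℝ) ^ (-(1 : ℝ) / d) with hBdef
  have hp : p.Prime := Nat.minFac_prime (by omega)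
  have hp0 : (0 : ℝ) < p := by exact_mod_cast hp.pos
  have hn0 : (0 : ℝ) < n := by positivity
  have hdp : d < p := by
    have h : Real.exp (1.85 * d) * (p : ℝ) ^ (-(1 : ℝ) / d) ≤ 1 := by
      refine le_of_mul_le_mul_left ?_ hn0
      have hc : (0 : ℝ) ≤ c := by positivity
      have : n * (Real.exp (1.85 * d) * (p : ℝ) ^ (-(1 : ℝ) / d)) = B := by rw [hBdef]; ring
      rw [this]
      linarith
    exact_mod_cast natCast_lt_of_exp_mul_rpow_le_one hp0 hd h
  have hcoeff : ∀ q : ℕ, q.Prime → q ∣ n → ∃ i, 1 ≤ i ∧ i ≤ d ∧ (f.coeff i : ZMod q) ≠ 0 := by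
    intro q hq hqn
    by_contra! h
    refine hq.one_lt.ne' (Nat.dvd_one.1 (hgcd ▸ Nat.dvd_gcd (Finset.dvd_gcd fun i hi => ?_) hqn))
    rw [Finset.mem_Icc] at hi
    exact Int.natCast_dvd.1 ((ZMod.intCast_zmod_eq_zero_iff_dvd _ q).1 (h i hi.1 hi.2))
  have hsum : ∀ ψ : AddChar (ZMod n) ℂ, ψ ≠ 1 →
      ‖∑ x, ψ ((f.map (Int.castRingHom (ZMod n))).eval x)‖ ≤ B :=
    fun ψ hψ => norm_sum_zmod_le hψ hdeg.le hdp hcoeff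
  have horder : ∀ ψ : AddChar (ZMod n) ℂ, ψ ≠ 1 → p ≤ orderOf ψ := by
    intro ψ hψ
    have hdvd : orderOf ψ ∣ n := by
      refine orderOf_dvd_of_pow_eq_one (AddChar.ext _ _ fun x => ?_)
      rw [AddChar.pow_apply, ← AddChar.map_nsmul_eq_pow]
      simp
    have h0 : orderOf ψ ≠ 0 := fun h => by
      rw [h, Nat.zero_dvd] at hdvd
      omega
    have h1 : orderOf ψ ≠ 1 := by rwa [Ne, orderOf_eq_one_iff]
    exact Nat.minFac_le_of_dvd (by omega) hdvd
  have hcompl : ((Dᶜ).card : ℝ) = c := by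
    have h : ((D.card + Dᶜ.card : ℕ) : ℝ) = n := by
      rw [Finset.card_add_card_compl, ZMod.card]
    push_cast at h
    linarith
  have hB1 : 1 ≤ B := by
    have hp1 : (1 : ℝ) ≤ p := by exact_mod_cast hp.one_lt.le
    have hpn : (p : ℝ) ≤ n := by exact_mod_cast Nat.minFac_le (by omega)
    have hd1 : (1 : ℝ) / d ≤ 1 := (div_le_one (by positivity)).2 (by exact_mod_cast hd)
    have hexp : 1 ≤ Real.exp (1.85 * d) := Real.one_le_exp (by positivity)
    calc (1 : ℝ) ≤ (p : ℝ) ^ (1 + -(1 : ℝ) / d) :=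
          Real.one_le_rpow hp1 (by rw [neg_div]; linarith)
      _ = 1 * p * (p : ℝ) ^ (-(1 : ℝ) / d) := by rw [Real.rpow_add hp0, Real.rpow_one, one_mul]
      _ ≤ B := by
          rw [hBdef]
          gcongr
  have hgap : 0 ≤ (n : ℝ) - c - (B + c) := by linarith
  have hδ : (1 : ℝ) / p ≤ deltaMoebius n := one_div_minFac_le_deltaMoebius hn
  have hmain : B + c + ((n : ℝ) - c - (B + c)) / p
      ≤ deltaMoebius n * ((n : ℝ) - c) + (1 - deltaMoebius n) * (B + c) := by
    have := mul_le_mul_of_nonneg_right hδ hgap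
    rw [one_div_mul_eq_div] at this
    linarith
  set A := deltaMoebius n * ((n : ℝ) - c) + (1 - deltaMoebius n) * (B + c)
  have hA : 1 ≤ A := by
    have : 0 ≤ ((n : ℝ) - c - (B + c)) / p := by positivity
    have hc : (0 : ℝ) ≤ c := by positivity
    linarith
  rw [realChoose_add_sub_one, ← hD, realChoose_natCast]
  have h := abs_polySubsetSumCount_sub_le D (f.map (Int.castRingHom (ZMod n))) k b
    (fun ψ hψ => norm_sum_powersetCard_le D _ hp.pos hsum horder (by rw [hcompl, hD]; exact hbig)
      hA (by rwa [hcompl, hD]) hψ k) (multichooseReal_nonneg (zero_le_one.trans hA) k)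
  rwa [ZMod.card] at h
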